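/- arXiv:1305.5295 — 2 statements merged into one kernel-verified Lean document; each statement's English description precedes it below -/
import Mathlib

section
/- Let F be a field of characteristic different from 2 which has the C_n property, and let α = (a_1, …, a_n) and β = (b_1, …, b_n) be two symbols in k_n(F) = K_n^M(F)/2K_n^M(F). Then either one of α, β is zero, or there exist c_1, …, c_{n-1}, c, c' ∈ F* such that α = (c_1, …, c_{n-1}, c) and β = (c_1, …, c_{n-1}, c'), i.e., α and β admit symbol presentations sharing their first n−1 slots. -/
universe u

open MvPolynomial

/-- A field `F` has the `C_n` property if every homogeneous polynomial of
positive degree `d` in more than `d ^ n` variables has a nontrivial zero. -/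
def IsCField (F : Type u) [Field F] (n : ℕ) : Prop :=
  ∀ (d N : ℕ), 0 < d → d ^ n < N →
    ∀ f : MvPolynomial (Fin N) F, f.IsHomogeneous d →
      ∃ x : Fin N → F, x ≠ 0 ∧ MvPolynomial.eval x f = 0

variable (F : Type u) [Field F]

/-- Multilinearity relations for Milnor K-theory. -/
def mlRel (n : ℕ) : Set (FreeAbelianGroup (Fin n → Fˣ)) :=
  {z | ∃ (a : Fin n → Fˣ) (i : Fin n) (u v : Fˣ), a i = u * v ∧
        z = FreeAbelianGroup.of a - FreeAbelianGroup.of (Function.update a i u)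
              - FreeAbelianGroup.of (Function.update a i v)}

/-- Steinberg relations for Milnor K-theory. -/
def stRel (n : ℕ) : Set (FreeAbelianGroup (Fin n → Fˣ)) :=
  {z | ∃ (a : Fin n → Fˣ) (i j : Fin n), (i : ℕ) + 1 = (j : ℕ) ∧
        ((a i : F) + (a j : F) = 1) ∧ z = FreeAbelianGroup.of a}

/-- The subgroup of relations defining the `n`-th Milnor K-group. -/
def milnorRel (n : ℕ) : AddSubgroup (FreeAbelianGroup (Fin n → Fˣ)) :=
  AddSubgroup.closure (mlRel F n ∪ stRel F n)

/-- The `n`-th Milnor K-group `K_n^M(F)`. -/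
def MilnorK (n : ℕ) : Type u :=
  FreeAbelianGroup (Fin n → Fˣ) ⧸ milnorRel F n

instance (n : ℕ) : AddCommGroup (MilnorK F n) :=
  QuotientAddGroup.Quotient.addCommGroup _

/-- The subgroup `p·K_n^M(F)` of `K_n^M(F)`. -/
def pMul (p n : ℕ) : AddSubgroup (MilnorK F n) :=
  AddSubgroup.closure {x | ∃ y : MilnorK F n, x = p • y}

/-- `k_n(F) = K_n^M(F)/pK_n^M(F)`. -/
def kMod (p n : ℕ) : Type u := MilnorK F n ⧸ pMul F p n

instance (p n : ℕ) : AddCommGroup (kMod F p n) :=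
  QuotientAddGroup.Quotient.addCommGroup _

/-- The symbol `(a 1, …, a n)` in `k_n(F)`. -/
def symbol (p : ℕ) {n : ℕ} (a : Fin n → Fˣ) : kMod F p n :=
  QuotientAddGroup.mk (QuotientAddGroup.mk (FreeAbelianGroup.of a))

section SymbolLinkage

variable {F}

theorem bilin_neg_self {A : Type*} [AddCommGroup A] {B : Fˣ → Fˣ → A}
    (hl : ∀ u v w, B (u * v) w = B u w + B v w) (hr : ∀ u v w, B u (v * w) = B u v + B u w)
    (hs : ∀ u v : Fˣ, (u : F) + v = 1 → B u v = 0) (a : Fˣ) : B a (-a) = 0 := by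
  have one_left : ∀ w, B 1 w = 0 := fun w => by simpa using hl 1 1 w
  have one_right : ∀ w, B w 1 = 0 := fun w => by simpa using hr w 1 1
  by_cases ha : a = 1
  · rw [ha, one_left]
  have ha' : (a : F) ≠ 1 := fun h => ha (Units.ext h)
  have ha0 : (a : F) ≠ 0 := a.ne_zero
  let p : Fˣ := Units.mk0 (1 - (a : F)) (sub_ne_zero.2 ha'.symm)
  let q : Fˣ := Units.mk0 (1 - (a : F)⁻¹)
    (sub_ne_zero.2 fun h => ha' (by rw [← inv_inv (a : F), ← h, inv_one]))
  have hp : B a p = 0 := hs _ _ (by simp [p])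
  have hq : B a⁻¹ q = 0 := hs _ _ (by simp [q])
  have hpq : -a * q = p := Units.ext (by simp [p, q]; field_simp; ring)
  have h1 : B a⁻¹ q + B a q = 0 := by rw [← hl, inv_mul_cancel, one_left]
  have h2 : B a (-a) + B a q = B a p := by rw [← hr, hpq]
  rw [hq, zero_add] at h1
  rw [h1, hp, add_zero] at h2
  exact h2

theorem bilin_swap {A : Type*} [AddCommGroup A] {B : Fˣ → Fˣ → A}
    (hl : ∀ u v w, B (u * v) w = B u w + B v w) (hr : ∀ u v w, B u (v * w) = B u v + B u w)
    (hs : ∀ u v : Fˣ, (u : F) + v = 1 → B u v = 0) (a b : Fˣ) : B a b = -B b a := by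
  have key := bilin_neg_self hl hr hs
  have h1 := key (a * b)
  have h2 : B a (-(a * b)) = B a (-a) + B a b := by rw [← hr, neg_mul]
  have h3 : B b (-(a * b)) = B b (-b) + B b a := by rw [← hr, neg_mul, mul_comm a b]
  rw [hl, h2, h3, key a, key b, zero_add, zero_add] at h1
  exact eq_neg_of_add_eq_zero_left h1

/-- A map from `Fˣ` to a commutative ring of characteristic two that satisfies the
relations of Milnor K-theory modulo `2`. -/
structure IsSteinbergMap {R : Type*} [CommRing R] (h : Fˣ → R) : Prop where
  map_mul : ∀ u v, h (u * v) = h u + h v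
  steinberg : ∀ u v : Fˣ, (u : F) + v = 1 → h u * h v = 0
  two_eq_zero : (2 : R) = 0

/-- The value at `x` of the diagonal quadratic form with the given coefficients. -/
def diagEval : List F → (ℕ → F) → F
  | [], _ => 0
  | c :: L, x => c * x 0 ^ 2 + diagEval L (fun i => x (i + 1))

/-- The vector `x` is nonzero in the range of the variables of the diagonal form `L`. -/
def NonzeroOn (L : List F) (x : ℕ → F) : Prop := ∃ i < L.length, x i ≠ 0

theorem diagEval_append (L M : List F) (x : ℕ → F) :
    diagEval (L ++ M) x = diagEval L x + diagEval M (fun i => x (i + L.length)) := by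
  induction L generalizing x with
  | nil => simp [diagEval]
  | cons c L ih => simp [diagEval, ih, add_assoc]

theorem diagEval_map_mul (c : F) (L : List F) (x : ℕ → F) :
    diagEval (L.map (c * ·)) x = c * diagEval L x := by
  induction L generalizing x with
  | nil => simp [diagEval]
  | cons d L ih => simp [diagEval, ih]; ring

theorem NonzeroOn.append {L M : List F} {x : ℕ → F} (h : NonzeroOn (L ++ M) x) :
    NonzeroOn L x ∨ NonzeroOn M (fun i => x (i + L.length)) := by
  obtain ⟨i, hi, hx⟩ := h
  rw [List.length_append] at hi
  by_cases hL : i < L.length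
  · exact Or.inl ⟨i, hL, hx⟩
  · refine Or.inr ⟨i - L.length, by omega, ?_⟩
    simpa only [Nat.sub_add_cancel (not_lt.1 hL)] using hx

theorem NonzeroOn.of_map {f : F → F} {L : List F} {x : ℕ → F} (h : NonzeroOn (L.map f) x) :
    NonzeroOn L x := by
  simpa [NonzeroOn] using h

theorem diagEval_eq_sum (L : List F) (x : ℕ → F) :
    diagEval L x = ∑ i : Fin L.length, L.get i * x i ^ 2 := by
  induction L generalizing x with
  | nil => simp [diagEval]
  | cons c L ih =>
    rw [diagEval, ih]
    exact (Fin.sum_univ_succ (n := L.length)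
      (fun i : Fin (L.length + 1) => (c :: L).get i * x i ^ 2)).symm

theorem IsCField.exists_diagEval_eq_zero {n : ℕ} (hC : IsCField F n) {L : List F}
    (hL : 2 ^ n < L.length) : ∃ x, NonzeroOn L x ∧ diagEval L x = 0 := by
  obtain ⟨x, hx, h0⟩ := hC 2 L.length two_pos hL
    (∑ i : Fin L.length, C (L.get i) * X i ^ 2) (IsHomogeneous.sum _ _ _ fun i _ => by
      simpa using (isHomogeneous_C (Fin L.length) (L.get i)).mul ((isHomogeneous_X F i).pow 2))
  obtain ⟨i, hi⟩ := Function.ne_iff.1 hx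
  refine ⟨fun j => if hj : j < L.length then x ⟨j, hj⟩ else 0, ⟨i, i.2, by simpa using hi⟩, ?_⟩
  rw [diagEval_eq_sum]
  simpa using h0

/-- The coefficients of the Pfister form `⟨1, -a₁⟩ ⊗ ⋯ ⊗ ⟨1, -aₙ⟩`. -/
def pfister : List Fˣ → List F
  | [] => [1]
  | a :: l => pfister l ++ (pfister l).map (-(a : F) * ·)

/-- The coefficients of the tensor product of the Pfister form of `σ` with the negative of the
pure part of the Pfister form of the second list. -/
def purePfister (σ : List Fˣ) : List Fˣ → List F
  | [] => []
  | b :: t => purePfister σ t ++ (pfister (t ++ σ)).map ((b : F) * ·)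

theorem length_pfister (l : List Fˣ) : (pfister l).length = 2 ^ l.length := by
  induction l with
  | nil => rfl
  | cons a l ih => simp [pfister, ih]; ring

theorem length_purePfister (σ τ : List Fˣ) :
    (purePfister σ τ).length + 2 ^ σ.length = 2 ^ (τ.length + σ.length) := by
  induction τ with
  | nil => simp [purePfister]
  | cons b t ih =>
    simp only [purePfister, List.length_append, List.length_map, length_pfister, List.length_cons]
    rw [show t.length + 1 + σ.length = t.length + σ.length + 1 by ring, pow_succ]
    omega

namespace IsSteinbergMap

variable {R : Type*} [CommRing R] {h : Fˣ → R}

theorem mul_neg_self (H : IsSteinbergMap h) (a : Fˣ) : h a * h (-a) = 0 :=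
  bilin_neg_self (B := fun u v => h u * h v) (fun u v w => by simp only [H.map_mul]; ring)
    (fun u v w => by simp only [H.map_mul]; ring) H.steinberg a

/-- `{x, y} = {z, xyz}` whenever `x + y = z`. -/
theorem mul_eq_of_add_eq (H : IsSteinbergMap h) {x y z : Fˣ} (hz : (x : F) + y = z) :
    h x * h y = h z * h (x * y * z) := by
  have h1 : h (x * z⁻¹) * h (y * z⁻¹) = 0 := H.steinberg _ _ (by
    rw [Units.val_mul, Units.val_mul, ← add_mul, hz, Units.mul_inv])
  have h2 : h 1 = 0 := by simpa using H.map_mul 1 1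
  have h3 : h z + h z⁻¹ = 0 := by rw [← H.map_mul, mul_inv_cancel, h2]
  rw [H.map_mul, H.map_mul] at h1
  rw [H.map_mul, H.map_mul]
  linear_combination h1 - (h x + h y - h z + h z⁻¹) * h3 - h z ^ 2 * H.two_eq_zero

/-- Values of a Pfister form annihilate its symbol. -/
theorem prod_mul_eq_zero (H : IsSteinbergMap h) (l : List Fˣ) (x : ℕ → F) (d : Fˣ)
    (hd : diagEval (pfister l) x = d) :
    (l.map h).prod * h d = 0 := by
  induction l generalizing x d with
  | nil =>
    have hx : x 0 ≠ 0 := fun h0 => d.ne_zero (by simpa [pfister, diagEval, h0] using hd.symm)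
    have : d = Units.mk0 (x 0) hx * Units.mk0 (x 0) hx :=
      Units.ext (by simpa [pfister, diagEval, sq] using hd.symm)
    rw [this, H.map_mul]
    linear_combination (List.map h []).prod * h (Units.mk0 (x 0) hx) * H.two_eq_zero
  | cons a l ih =>
    rw [pfister, diagEval_append, diagEval_map_mul] at hd
    set y : ℕ → F := fun i => x (i + (pfister l).length)
    rw [List.map_cons, List.prod_cons]
    by_cases hf : diagEval (pfister l) y = 0
    · rw [hf, mul_zero, add_zero] at hd
      linear_combination h a * ih x d hd
    lift diagEval (pfister l) y to Fˣ using IsUnit.mk0 _ hf with f hf'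
    have ihf := ih y f hf'.symm
    by_cases he : diagEval (pfister l) x = 0
    · have : d = -a * f := Units.ext (by rw [← hd, he]; simp)
      rw [this, H.map_mul]
      linear_combination (l.map h).prod * H.mul_neg_self a + h a * ihf
    lift diagEval (pfister l) x to Fˣ using IsUnit.mk0 _ he with e he'
    have ihe := ih x e he'.symm
    have hst : h (a * (f * e⁻¹)) * h (d * e⁻¹) = 0 := H.steinberg _ _ (by
      have := e.ne_zero
      push_cast
      rw [← hd]
      field_simp
      ring)
    have h1 : h 1 = 0 := by simpa using H.map_mul 1 1
    have hinv : h e + h e⁻¹ = 0 := by rw [← H.map_mul, mul_inv_cancel, h1]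
    rw [H.map_mul, H.map_mul, H.map_mul] at hst
    linear_combination (l.map h).prod * hst - (h d + h e⁻¹) * ihf + (h a + h d + h e⁻¹) * ihe
      - (l.map h).prod * (h a + h d + h e⁻¹) * hinv

/-- The symbol of an isotropic Pfister form vanishes. -/
theorem prod_eq_zero_of_isotropic (H : IsSteinbergMap h) (l : List Fˣ) (x : ℕ → F)
    (hx : NonzeroOn (pfister l) x)
    (h0 : diagEval (pfister l) x = 0) : (l.map h).prod = 0 := by
  induction l generalizing x with
  | nil =>
    obtain ⟨i, hi, hxi⟩ := hx
    obtain rfl : i = 0 := by simpa [pfister] using hi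
    exact absurd h0 (by simpa [pfister, diagEval] using hxi)
  | cons a l ih =>
    rw [pfister, diagEval_append, diagEval_map_mul] at h0
    set y : ℕ → F := fun i => x (i + (pfister l).length)
    rw [List.map_cons, List.prod_cons]
    by_cases hf : diagEval (pfister l) y = 0
    · have he : diagEval (pfister l) x = 0 := by simpa [hf] using h0
      have : (l.map h).prod = 0 := (NonzeroOn.append hx).elim (fun hx => ih x hx he)
        fun hx => ih y (NonzeroOn.of_map hx) hf
      rw [this, mul_zero]
    have he : diagEval (pfister l) x = a * diagEval (pfister l) y := by linear_combination h0
    lift diagEval (pfister l) y to Fˣ using IsUnit.mk0 _ hf with f hf'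
    have ihf := H.prod_mul_eq_zero l y f hf'.symm
    have ihe := H.prod_mul_eq_zero l x (a * f) (by simpa using he)
    rw [H.map_mul] at ihe
    linear_combination ihe - ihf

/-- A nonzero value `c` of the relative pure part can be made a slot of the symbol. -/
theorem exists_slot (H : IsSteinbergMap h) (σ τ : List Fˣ) (x : ℕ → F) (c : Fˣ)
    (hc : diagEval (purePfister σ τ) x = c) :
    ∃ τ' : List Fˣ, τ'.length + 1 = τ.length ∧
      (σ.map h).prod * (τ.map h).prod = (σ.map h).prod * (h c * (τ'.map h).prod) := by
  induction τ generalizing x c with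
  | nil => exact absurd hc.symm c.ne_zero
  | cons b t ih =>
    rw [purePfister, diagEval_append, diagEval_map_mul] at hc
    set y : ℕ → F := fun i => x (i + (purePfister σ t).length)
    by_cases hw : diagEval (pfister (t ++ σ)) y = 0
    · rw [hw, mul_zero, add_zero] at hc
      obtain ⟨t', ht', e⟩ := ih x c hc
      refine ⟨b :: t', by simp [ht'], ?_⟩
      simp only [List.map_cons, List.prod_cons]
      linear_combination h b * e
    lift diagEval (pfister (t ++ σ)) y to Fˣ using IsUnit.mk0 _ hw with w hw'
    have hann := H.prod_mul_eq_zero _ y w hw'.symm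
    rw [List.map_append, List.prod_append] at hann
    by_cases hu : diagEval (purePfister σ t) x = 0
    · refine ⟨t, rfl, ?_⟩
      have : c = b * w := Units.ext (by rw [← hc, hu]; simp)
      rw [this, H.map_mul, List.map_cons, List.prod_cons]
      linear_combination -hann
    lift diagEval (purePfister σ t) x to Fˣ using IsUnit.mk0 _ hu with v hv'
    obtain ⟨t', ht', e⟩ := ih x v hv'.symm
    refine ⟨v * (b * w) * c :: t', by simp [ht'], ?_⟩
    have hadd : h v * h (b * w) = h c * h (v * (b * w) * c) :=
      H.mul_eq_of_add_eq (by simpa using hc)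
    simp only [List.map_cons, List.prod_cons]
    rw [H.map_mul b w] at hadd
    linear_combination (h b + h w) * e + (σ.map h).prod * (t'.map h).prod * hadd - hann

/-- The symbol vanishes when the relative pure part is isotropic. -/
theorem prod_eq_zero_of_pure_isotropic (H : IsSteinbergMap h) (σ τ : List Fˣ) (x : ℕ → F)
    (hx : NonzeroOn (purePfister σ τ) x) (h0 : diagEval (purePfister σ τ) x = 0) :
    (σ.map h).prod * (τ.map h).prod = 0 := by
  induction τ generalizing x with
  | nil =>
    obtain ⟨i, hi, -⟩ := hx
    exact absurd hi (by simp [purePfister])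
  | cons b t ih =>
    rw [purePfister, diagEval_append, diagEval_map_mul] at h0
    set y : ℕ → F := fun i => x (i + (purePfister σ t).length)
    rw [List.map_cons, List.prod_cons]
    by_cases hw : diagEval (pfister (t ++ σ)) y = 0
    · have hu : diagEval (purePfister σ t) x = 0 := by simpa [hw] using h0
      rcases NonzeroOn.append hx with hx | hx
      · linear_combination h b * ih x hx hu
      · have := H.prod_eq_zero_of_isotropic _ y (NonzeroOn.of_map hx) hw
        rw [List.map_append, List.prod_append] at this
        linear_combination h b * this
    have hv : diagEval (purePfister σ t) x = -(b * diagEval (pfister (t ++ σ)) y) := by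
      linear_combination h0
    lift diagEval (pfister (t ++ σ)) y to Fˣ using IsUnit.mk0 _ hw with w hw'
    have hann := H.prod_mul_eq_zero _ y w hw'.symm
    rw [List.map_append, List.prod_append] at hann
    obtain ⟨t', -, e⟩ := H.exists_slot σ t x (-(b * w)) (by simpa using hv)
    have hneg := H.mul_neg_self (b * w)
    rw [H.map_mul b w] at hneg
    linear_combination (h b + h w) * e + (σ.map h).prod * (t'.map h).prod * hneg - hann

theorem exists_common_slots (H : IsSteinbergMap h) {n : ℕ} (hC : IsCField F n) (a b : List Fˣ)
    (ha : a.length = n) (hb : b.length = n) (r : ℕ) (hr : r + 1 ≤ n) :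
    (a.map h).prod = 0 ∨ (b.map h).prod = 0 ∨ ∃ σ τ ρ : List Fˣ,
      σ.length = r ∧ τ.length + r = n ∧ ρ.length + r = n ∧
      (a.map h).prod = (σ.map h).prod * (τ.map h).prod ∧
      (b.map h).prod = (σ.map h).prod * (ρ.map h).prod := by
  induction r with
  | zero => exact Or.inr (Or.inr ⟨[], a, b, by simp [ha, hb]⟩)
  | succ r ih =>
    obtain h0 | h0 | ⟨σ, τ, ρ, hσ, hτ, hρ, eτ, eρ⟩ := ih (by omega)
    · exact Or.inl h0
    · exact Or.inr (Or.inl h0)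
    have hlτ := length_purePfister σ τ
    have hlρ := length_purePfister σ ρ
    rw [hσ, hτ] at hlτ
    rw [hσ, hρ] at hlρ
    have hpow : 4 * 2 ^ r ≤ 2 ^ n := by
      rw [show 4 = 2 ^ 2 by norm_num, ← pow_add]
      exact Nat.pow_le_pow_right two_pos (by omega)
    have hpos : 0 < 2 ^ r := by positivity
    obtain ⟨x, hx, hx0⟩ := hC.exists_diagEval_eq_zero
      (L := purePfister σ τ ++ (purePfister σ ρ).map ((-1 : F) * ·))
      (by rw [List.length_append, List.length_map]; omega)
    rw [diagEval_append, diagEval_map_mul] at hx0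
    set y : ℕ → F := fun i => x (i + (purePfister σ τ).length)
    have hxy : diagEval (purePfister σ τ) x = diagEval (purePfister σ ρ) y := by
      linear_combination hx0
    by_cases hc : diagEval (purePfister σ τ) x = 0
    · rcases NonzeroOn.append hx with hx | hx
      · exact Or.inl (eτ.trans (H.prod_eq_zero_of_pure_isotropic σ τ x hx hc))
      · exact Or.inr (Or.inl (eρ.trans (H.prod_eq_zero_of_pure_isotropic σ ρ y
          (NonzeroOn.of_map hx) (hxy ▸ hc))))
    obtain ⟨τ', hτ', e⟩ := H.exists_slot σ τ x (Units.mk0 _ hc) rfl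
    obtain ⟨ρ', hρ', e'⟩ := H.exists_slot σ ρ y (Units.mk0 _ hc) hxy.symm
    refine Or.inr (Or.inr ⟨σ ++ [Units.mk0 _ hc], τ', ρ', by simp [hσ], by omega, by omega, ?_, ?_⟩)
    · rw [eτ, e]; simp [mul_assoc]
    · rw [eρ, e']; simp [mul_assoc]

end IsSteinbergMap

theorem two_nsmul_kMod (n : ℕ) (x : kMod F 2 n) : 2 • x = 0 := by
  induction x using QuotientAddGroup.induction_on with
  | H y =>
    exact (QuotientAddGroup.eq_zero_iff _).2 (AddSubgroup.subset_closure ⟨y, rfl⟩)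

theorem symbol_eq_zero_of_mem {n : ℕ} {z : FreeAbelianGroup (Fin n → Fˣ)}
    (hz : z ∈ milnorRel F n) :
    (QuotientAddGroup.mk (QuotientAddGroup.mk z : MilnorK F n) : kMod F 2 n) = 0 := by
  rw [(QuotientAddGroup.eq_zero_iff (N := milnorRel F n) z).2 hz]
  rfl

theorem symbol_update_mul {n : ℕ} (a : Fin n → Fˣ) (i : Fin n) (u v : Fˣ) :
    symbol F 2 (Function.update a i (u * v)) =
      symbol F 2 (Function.update a i u) + symbol F 2 (Function.update a i v) := by
  have : FreeAbelianGroup.of (Function.update a i (u * v)) -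
      FreeAbelianGroup.of (Function.update a i u) -
      FreeAbelianGroup.of (Function.update a i v) ∈ milnorRel F n :=
    AddSubgroup.subset_closure (Or.inl ⟨Function.update a i (u * v), i, u, v,
      Function.update_self .., by rw [Function.update_idem, Function.update_idem]⟩)
  have h0 : symbol F 2 (Function.update a i (u * v)) -
      symbol F 2 (Function.update a i u) - symbol F 2 (Function.update a i v) = 0 :=
    symbol_eq_zero_of_mem this
  rwa [sub_sub, sub_eq_zero] at h0

theorem symbol_eq_zero_of_steinberg {n : ℕ} (a : Fin n → Fˣ) (i j : Fin n)
    (hij : (i : ℕ) + 1 = j) (h : (a i : F) + a j = 1) : symbol F 2 a = 0 :=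
  symbol_eq_zero_of_mem (AddSubgroup.subset_closure (Or.inr ⟨a, i, j, hij, h, rfl⟩))

/-- The symbol in `k_n(F)` of a list of units, which is zero for lists of length other than `n`. -/
noncomputable def listSymbol (n : ℕ) (l : List Fˣ) : kMod F 2 n :=
  if l.length = n then symbol F 2 (fun i : Fin n => l.getD i 1) else 0

theorem listSymbol_mul (n : ℕ) (l l' : List Fˣ) (u v : Fˣ) :
    listSymbol n (l ++ (u * v) :: l') =
      listSymbol n (l ++ u :: l') + listSymbol n (l ++ v :: l') := by
  by_cases hn : l.length + (l'.length + 1) = n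
  · have key : ∀ w, (fun i : Fin n => (l ++ w :: l').getD i 1) =
        Function.update (fun i : Fin n => (l ++ 1 :: l').getD i 1) ⟨l.length, by omega⟩ w := by
      intro w
      funext i
      rcases lt_trichotomy (i : ℕ) l.length with hi | hi | hi
      · rw [Function.update_of_ne (by simp [Fin.ext_iff, hi.ne])]
        simp [List.getElem?_append_left hi]
      · rw [show (⟨l.length, by omega⟩ : Fin n) = i from Fin.ext hi.symm]
        simp [hi]
      · rw [Function.update_of_ne (by simp [Fin.ext_iff, hi.ne'])]
        obtain ⟨k, hk⟩ := Nat.exists_eq_add_of_lt hi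
        simp [hk, List.getElem?_append_right, add_assoc]
    simp only [listSymbol, List.length_append, List.length_cons, hn, if_true]
    rw [key, key u, key v, symbol_update_mul]
  · simp [listSymbol, hn]

theorem listSymbol_steinberg (n : ℕ) (l l' : List Fˣ) (u v : Fˣ) (h : (u : F) + v = 1) :
    listSymbol n (l ++ u :: v :: l') = 0 := by
  by_cases hn : (l ++ u :: v :: l').length = n
  · rw [listSymbol, if_pos hn]
    rw [List.length_append, List.length_cons, List.length_cons] at hn
    refine symbol_eq_zero_of_steinberg _ ⟨l.length, by omega⟩ ⟨l.length + 1, by omega⟩ rfl ?_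
    simpa using h
  · rw [listSymbol, if_neg hn]

theorem listSymbol_swap (n : ℕ) (l l' : List Fˣ) (u v : Fˣ) :
    listSymbol n (l ++ u :: v :: l') = listSymbol n (l ++ v :: u :: l') := by
  have := bilin_swap (B := fun u v => listSymbol n (l ++ u :: v :: l'))
    (fun u v w => listSymbol_mul n l (w :: l') u v)
    (fun u v w => by simpa using listSymbol_mul n (l ++ [u]) l' v w)
    (fun u v h => listSymbol_steinberg n l l' u v h) u v
  refine this.trans (neg_eq_of_add_eq_zero_left ?_)
  rw [← two_nsmul, two_nsmul_kMod]

theorem listSymbol_perm (n : ℕ) {l l' : List Fˣ} (h : l.Perm l') (p : List Fˣ) :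
    listSymbol n (p ++ l) = listSymbol n (p ++ l') := by
  induction h generalizing p with
  | nil => rfl
  | cons a _ ih => simpa using ih (p ++ [a])
  | swap a b l => exact listSymbol_swap n p l b a
  | trans _ _ ih₁ ih₂ => exact (ih₁ p).trans (ih₂ p)

/-- The symbol in `k_n(F)` of a multiset of units. -/
noncomputable def multisetSymbol (n : ℕ) (s : Multiset Fˣ) : kMod F 2 n :=
  Quotient.liftOn s (listSymbol n) fun _ _ h => listSymbol_perm n h []

theorem multisetSymbol_mul (n : ℕ) (s : Multiset Fˣ) (u v : Fˣ) :
    multisetSymbol n (s + {u * v}) = multisetSymbol n (s + {u}) + multisetSymbol n (s + {v}) := by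
  induction s using Quotient.inductionOn with
  | h l => exact listSymbol_mul n l [] u v

theorem multisetSymbol_steinberg (n : ℕ) (s : Multiset Fˣ) (u v : Fˣ) (h : (u : F) + v = 1) :
    multisetSymbol n (s + ({u} + {v})) = 0 := by
  induction s using Quotient.inductionOn with
  | h l => exact listSymbol_steinberg n l [] u v h

variable (F) in
/-- The relations of Milnor K-theory modulo `2` in the commutative ring freely generated by
the units of `F`. -/
def kRingRel : Set (AddMonoidAlgebra ℤ (Multiset Fˣ)) :=
  {z | (∃ u v : Fˣ, z = .single {u * v} 1 - .single {u} 1 - .single {v} 1) ∨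
    (∃ u v : Fˣ, (u : F) + v = 1 ∧ z = .single ({u} + {v}) 1) ∨ z = .single 0 2}

/-- The additive map to `k_n(F)` that sends a multiset of units to its symbol. -/
noncomputable def toKMod (n : ℕ) : AddMonoidAlgebra ℤ (Multiset Fˣ) →+ kMod F 2 n :=
  (Finsupp.liftAddHom fun s => (zmultiplesHom _ (multisetSymbol n s))).comp
    (AddMonoidAlgebra.coeffAddEquiv).toAddMonoidHom

theorem toKMod_single (n : ℕ) (s : Multiset Fˣ) (k : ℤ) :
    toKMod n (.single s k) = k • multisetSymbol n s := by
  simp [toKMod]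

theorem toKMod_single_mul_eq_zero (n : ℕ) {z : AddMonoidAlgebra ℤ (Multiset Fˣ)}
    (hz : z ∈ kRingRel F) (s : Multiset Fˣ) (k : ℤ) : toKMod n (.single s k * z) = 0 := by
  obtain ⟨u, v, h⟩ | ⟨u, v, huv, h⟩ | h := hz
  · rw [h, mul_sub, mul_sub, map_sub, map_sub, AddMonoidAlgebra.single_mul_single,
      AddMonoidAlgebra.single_mul_single, AddMonoidAlgebra.single_mul_single, toKMod_single,
      toKMod_single, toKMod_single, multisetSymbol_mul, smul_add, add_sub_cancel_left, sub_self]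
  · rw [h, AddMonoidAlgebra.single_mul_single, toKMod_single, multisetSymbol_steinberg n s u v huv,
      smul_zero]
  · rw [h, AddMonoidAlgebra.single_mul_single, toKMod_single, mul_smul, ofNat_zsmul,
      two_nsmul_kMod, smul_zero]

theorem toKMod_mul_eq_zero (n : ℕ) {z : AddMonoidAlgebra ℤ (Multiset Fˣ)} (hz : z ∈ kRingRel F)
    (r : AddMonoidAlgebra ℤ (Multiset Fˣ)) : toKMod n (r * z) = 0 := by
  induction r using AddMonoidAlgebra.induction_linear with
  | zero => rw [zero_mul, map_zero]
  | add x y hx hy => rw [add_mul, map_add, hx, hy, add_zero]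
  | single s k => exact toKMod_single_mul_eq_zero n hz s k

theorem toKMod_eq_zero_of_mem (n : ℕ) {z : AddMonoidAlgebra ℤ (Multiset Fˣ)}
    (hz : z ∈ Ideal.span (kRingRel F)) : toKMod n z = 0 := by
  suffices h : ∀ r, toKMod n (r * z) = 0 by simpa using h 1
  induction hz using Submodule.span_induction with
  | mem z hz => exact toKMod_mul_eq_zero n hz
  | zero => simp
  | add x y _ _ hx hy => intro r; rw [mul_add, map_add, hx, hy, add_zero]
  | smul s x _ hx => intro r; rw [smul_eq_mul, ← mul_assoc, hx]

/-- The class of a unit in the Milnor K-ring modulo `2`. -/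
noncomputable def kClass (u : Fˣ) : AddMonoidAlgebra ℤ (Multiset Fˣ) ⧸ Ideal.span (kRingRel F) :=
  Ideal.Quotient.mk _ (.single {u} 1)

theorem isSteinbergMap_kClass : IsSteinbergMap (kClass (F := F)) where
  map_mul u v := by
    rw [← sub_eq_zero, ← sub_sub]
    exact Ideal.Quotient.eq_zero_iff_mem.2 (Ideal.subset_span (Or.inl ⟨u, v, rfl⟩))
  steinberg u v h := by
    rw [kClass, kClass, ← map_mul, AddMonoidAlgebra.single_mul_single, one_mul]
    exact Ideal.Quotient.eq_zero_iff_mem.2 (Ideal.subset_span (Or.inr (Or.inl ⟨u, v, h, rfl⟩)))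
  two_eq_zero :=
    Ideal.Quotient.eq_zero_iff_mem.2 (Ideal.subset_span (Or.inr (Or.inr rfl)))

theorem prod_map_kClass (l : List Fˣ) :
    (l.map kClass).prod =
      Ideal.Quotient.mk (Ideal.span (kRingRel F)) (.single (l : Multiset Fˣ) 1) := by
  induction l with
  | nil => rfl
  | cons a l ih =>
    rw [List.map_cons, List.prod_cons, ih, kClass, ← map_mul, AddMonoidAlgebra.single_mul_single,
      one_mul, Multiset.singleton_add, Multiset.cons_coe]

theorem listSymbol_eq_of_prod_eq (n : ℕ) {l l' : List Fˣ}
    (h : (l.map kClass).prod = (l'.map kClass).prod) : listSymbol n l = listSymbol n l' := by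
  rw [prod_map_kClass, prod_map_kClass, Ideal.Quotient.eq] at h
  have := toKMod_eq_zero_of_mem n h
  rw [map_sub, toKMod_single, toKMod_single, one_zsmul, one_zsmul, sub_eq_zero] at this
  exact this

theorem listSymbol_eq_zero_of_prod_eq_zero (n : ℕ) {l : List Fˣ}
    (h : (l.map kClass).prod = 0) : listSymbol n l = 0 := by
  rw [prod_map_kClass, Ideal.Quotient.eq_zero_iff_mem] at h
  have := toKMod_eq_zero_of_mem n h
  rwa [toKMod_single, one_zsmul] at this

theorem listSymbol_ofFn {n : ℕ} (a : Fin n → Fˣ) : listSymbol n (List.ofFn a) = symbol F 2 a := by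
  rw [listSymbol, if_pos (List.length_ofFn)]
  congr 1
  funext i
  simp

end SymbolLinkage

/-- If `F` is a field of characteristic different from `2`
with the `C_n` property (here `n = m + 1`), and `α = (a_1, …, a_n)`,
`β = (b_1, …, b_n)` are symbols in `k_n(F) = K_n^M(F)/2K_n^M(F)`, then either
one of `α`, `β` is zero, or `α` and `β` admit symbol presentations sharing
their first `n - 1` slots. -/
theorem symbols_share_slots (F : Type u) [Field F] (m : ℕ)
    (hchar : ringChar F ≠ 2) (hC : IsCField F (m + 1))
    (a b : Fin (m + 1) → Fˣ) :
    symbol F 2 a = 0 ∨ symbol F 2 b = 0 ∨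
      ∃ (c : Fin m → Fˣ) (cl cl' : Fˣ),
        symbol F 2 a = symbol F 2 (Fin.snoc c cl) ∧
        symbol F 2 b = symbol F 2 (Fin.snoc c cl') := by
  have hzero : ∀ x : Fin (m + 1) → Fˣ, ((List.ofFn x).map kClass).prod = 0 → symbol F 2 x = 0 :=
    fun x hx => (listSymbol_ofFn x).symm.trans (listSymbol_eq_zero_of_prod_eq_zero _ hx)
  have hsnoc : ∀ (x : Fin (m + 1) → Fˣ) (c : Fin m → Fˣ) (d : Fˣ),
      ((List.ofFn x).map kClass).prod = ((List.ofFn c).map kClass).prod * ([d].map kClass).prod →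
      symbol F 2 x = symbol F 2 (Fin.snoc c d) := by
    intro x c d hx
    rw [← listSymbol_ofFn x, ← listSymbol_ofFn (Fin.snoc c d : Fin (m + 1) → Fˣ)]
    refine listSymbol_eq_of_prod_eq _ (hx.trans ?_)
    rw [List.ofFn_succ', ← List.prod_append, ← List.map_append]
    simp
  obtain h | h | ⟨σ, τ, ρ, hσ, hτ, hρ, eτ, eρ⟩ := isSteinbergMap_kClass.exists_common_slots hC
    (List.ofFn a) (List.ofFn b) List.length_ofFn List.length_ofFn m le_rfl
  · exact Or.inl (hzero a h)
  · exact Or.inr (Or.inl (hzero b h))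
  obtain ⟨d, rfl⟩ := List.length_eq_one_iff.1 (show τ.length = 1 by omega)
  obtain ⟨d', rfl⟩ := List.length_eq_one_iff.1 (show ρ.length = 1 by omega)
  subst hσ
  refine Or.inr (Or.inr ⟨σ.get, d, d', hsnoc a _ _ ?_, hsnoc b _ _ ?_⟩)
  · rw [eτ, List.ofFn_get]
  · rw [eρ, List.ofFn_get]
end

section
/- Let F be a field of characteristic different from 3 with the C_3 property. Then K_4^M(F)/3K_4^M(F) = 0. -/
universe u

open MvPolynomial

variable (F : Type u) [Field F]

/-- A bimultiplicative pairing on `Fˣ` satisfying the Steinberg relation. -/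
structure IsSteinberg {F : Type*} [Field F] {M : Type*} [AddCommGroup M]
    (g : Fˣ → Fˣ → M) : Prop where
  mul_left : ∀ u v x, g (u * v) x = g u x + g v x
  mul_right : ∀ x u v, g x (u * v) = g x u + g x v
  steinberg : ∀ u v : Fˣ, (u : F) + v = 1 → g u v = 0

namespace IsSteinberg

variable {F : Type*} [Field F] {M : Type*} [AddCommGroup M] {g : Fˣ → Fˣ → M}

lemma one_left (hg : IsSteinberg g) (x : Fˣ) : g 1 x = 0 := by
  simpa using hg.mul_left 1 1 x

lemma one_right (hg : IsSteinberg g) (x : Fˣ) : g x 1 = 0 := by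
  simpa using hg.mul_right x 1 1

lemma inv_left (hg : IsSteinberg g) (u x : Fˣ) : g u⁻¹ x = -g u x := by
  have h := hg.mul_left u⁻¹ u x
  rw [inv_mul_cancel, hg.one_left] at h
  exact eq_neg_of_add_eq_zero_left h.symm

lemma inv_right (hg : IsSteinberg g) (x u : Fˣ) : g x u⁻¹ = -g x u := by
  have h := hg.mul_right x u⁻¹ u
  rw [inv_mul_cancel, hg.one_right] at h
  exact eq_neg_of_add_eq_zero_left h.symm

lemma cube_left (hg : IsSteinberg g) (h3 : ∀ m : M, 3 • m = 0) (u x : Fˣ) :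
    g (u ^ 3) x = 0 := by
  rw [← h3 (g u x), pow_succ, pow_two, hg.mul_left, hg.mul_left]
  abel

lemma cube_right (hg : IsSteinberg g) (h3 : ∀ m : M, 3 • m = 0) (x u : Fˣ) :
    g x (u ^ 3) = 0 := by
  rw [← h3 (g x u), pow_succ, pow_two, hg.mul_right, hg.mul_right]
  abel

lemma self_neg (hg : IsSteinberg g) (u : Fˣ) : g u (-u) = 0 := by
  by_cases hu : u = 1
  · rw [hu, hg.one_left]
  have hu' : (u : F) ≠ 1 := fun h => hu (Units.ext h)
  have h1 : (1 - u : F) ≠ 0 := sub_ne_zero.2 hu'.symm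
  have h2 : (1 - (u : F)⁻¹) ≠ 0 := by
    rw [sub_ne_zero]
    exact fun h => hu' (inv_eq_one.1 h.symm)
  have key : -u = Units.mk0 _ h1 * (Units.mk0 _ h2)⁻¹ := by
    rw [eq_mul_inv_iff_mul_eq]
    ext
    have := u.ne_zero
    simp only [Units.val_mul, Units.val_neg, Units.val_mk0]
    field_simp
    ring
  have e1 : g u (Units.mk0 _ h1) = 0 := hg.steinberg _ _ (by simp)
  have e2 : g u⁻¹ (Units.mk0 _ h2) = 0 := hg.steinberg _ _ (by simp)
  rw [hg.inv_left, neg_eq_zero] at e2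
  rw [key, hg.mul_right, hg.inv_right, e1, e2, neg_zero, add_zero]

lemma self (hg : IsSteinberg g) (h3 : ∀ m : M, 3 • m = 0) (u : Fˣ) : g u u = 0 := by
  have h : u = (-1) ^ 3 * -u := by ext; simp; ring
  nth_rw 2 [h]
  rw [hg.mul_right, hg.cube_right h3, hg.self_neg, add_zero]

lemma swap (hg : IsSteinberg g) (h3 : ∀ m : M, 3 • m = 0) (u v : Fˣ) : g u v = -g v u := by
  have h := hg.self h3 (u * v)
  rw [hg.mul_left, hg.mul_right, hg.mul_right, hg.self h3, hg.self h3, zero_add, add_zero] at h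
  exact eq_neg_of_add_eq_zero_left h

/-- The units annihilated by `b` under a Steinberg pairing. -/
def ann (hg : IsSteinberg g) (b : Fˣ) : Subgroup Fˣ where
  carrier := {t | g b t = 0}
  mul_mem' {u v} hu hv := by
    rw [Set.mem_ofPred_eq] at *
    rw [hg.mul_right, hu, hv, add_zero]
  one_mem' := hg.one_right b
  inv_mem' {u} hu := by
    rw [Set.mem_ofPred_eq] at *
    rw [hg.inv_right, hu, neg_zero]

lemma mem_ann (hg : IsSteinberg g) {b t : Fˣ} : t ∈ hg.ann b ↔ g b t = 0 := Iff.rfl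

lemma cubes_le_ann (hg : IsSteinberg g) (h3 : ∀ m : M, 3 • m = 0) (b : Fˣ) :
    (powMonoidHom 3 : Fˣ →* Fˣ).range ≤ hg.ann b := by
  rintro _ ⟨w, rfl⟩
  exact hg.cube_right h3 b w

end IsSteinberg

/-- `x` is zero or a unit lying in the subgroup `W`. -/
def MemOrZero {F : Type*} [Field F] (W : Subgroup Fˣ) (x : F) : Prop :=
  ∀ t : Fˣ, (t : F) = x → t ∈ W

namespace MemOrZero

variable {F : Type*} [Field F] {W : Subgroup Fˣ} {x y : F}

lemma of_mem {t : Fˣ} (ht : t ∈ W) : MemOrZero W (t : F) := fun s hs => by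
  rwa [Units.ext hs]

lemma zero : MemOrZero W (0 : F) := fun t ht => absurd ht t.ne_zero

lemma mul (hx : MemOrZero W x) (hy : MemOrZero W y) : MemOrZero W (x * y) := by
  intro t ht
  have hxy : x * y ≠ 0 := ht ▸ t.ne_zero
  have hx0 := left_ne_zero_of_mul hxy
  have hy0 := right_ne_zero_of_mul hxy
  have e : t = Units.mk0 x hx0 * Units.mk0 y hy0 := Units.ext ht
  rw [e]
  exact W.mul_mem (hx _ rfl) (hy _ rfl)

lemma of_mul_right (h : MemOrZero W (x * y)) (hy : MemOrZero W y) (hy0 : y ≠ 0) :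
    MemOrZero W x := by
  intro t ht
  have h1 := h (t * Units.mk0 y hy0) (by simp [ht])
  exact (W.mul_mem_cancel_right (hy (Units.mk0 y hy0) rfl)).1 h1

lemma cube (hW : (powMonoidHom 3 : Fˣ →* Fˣ).range ≤ W) (x : F) : MemOrZero W (x ^ 3) := by
  intro t ht
  have hx : x ≠ 0 := by
    rintro rfl
    simp at ht
  exact hW ⟨Units.mk0 x hx, Units.ext (by simp [ht])⟩

/-- A vanishing sum `x + b y` of elements of `W ∪ {0}` is trivial when `b ∉ W`. -/
lemma eq_zero_of_add_mul_eq_zero (hW : (powMonoidHom 3 : Fˣ →* Fˣ).range ≤ W) {b : Fˣ}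
    (hb : b ∉ W) (hx : MemOrZero W x) (hy : MemOrZero W y) (h : x + b * y = 0) :
    x = 0 ∧ y = 0 := by
  by_cases hy0 : y = 0
  · simpa [hy0] using h
  · refine absurd ?_ hb
    have h1 : MemOrZero W (b : F) := by
      refine of_mul_right (y := y) ?_ hy hy0
      have e : (b : F) * y = (-1) ^ 3 * x := by linear_combination h
      rw [e]
      exact (cube hW _).mul hx
    exact h1 b rfl

lemma add_mul {M : Type*} [AddCommGroup M] {g : Fˣ → Fˣ → M} (hg : IsSteinberg g)
    (h3 : ∀ m : M, 3 • m = 0) (hW : ∀ w ∈ W, ∀ z, g w z = 0) (b : Fˣ)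
    (hx : MemOrZero W x) (hy : MemOrZero W y) : MemOrZero (hg.ann b) (x + b * y) := by
  have hW' : ∀ w ∈ W, ∀ z, g z w = 0 := fun w hw z => by
    rw [hg.swap h3, hW w hw, neg_zero]
  intro t ht
  rw [hg.mem_ann]
  by_cases hx0 : x = 0
  · have hy0 : y ≠ 0 := by
      rintro rfl
      exact t.ne_zero (by simp [ht, hx0])
    have e : t = b * Units.mk0 y hy0 := Units.ext (by simp [ht, hx0])
    rw [e, hg.mul_right, hg.self h3, hW' _ (hy _ rfl), add_zero]
  by_cases hy0 : y = 0
  · exact hW' t (hx t (by simp [ht, hy0])) b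
  have hs := hg.steinberg (Units.mk0 x hx0 * t⁻¹) (b * Units.mk0 y hy0 * t⁻¹) (by
    have := t.ne_zero
    simp only [Units.val_mul, Units.val_mk0, Units.val_inv_eq_inv_val]
    field_simp
    exact ht.symm)
  rw [hg.mul_left, hW _ (hx _ rfl), zero_add, hg.inv_left, hg.mul_right, hg.mul_right,
    hg.inv_right, hg.self h3, hW' (Units.mk0 y hy0) (hy _ rfl), neg_zero, add_zero, add_zero, neg_eq_zero] at hs
  rw [hg.swap h3, hs, neg_zero]

end MemOrZero

/-- The norm of `x + y θ + z θ²`, where `θ³ = a`. -/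
def cubicNorm {R : Type*} [CommRing R] (a x y z : R) : R :=
  x ^ 3 + a * y ^ 3 + a ^ 2 * z ^ 3 - 3 * a * x * y * z

/-- A seven-dimensional subform of the norm of the first Tits construction
obtained from `R[θ]`, `θ³ = a`, and the scalar `b`. -/
def titsNorm {R : Type*} [CommRing R] (a b : R) (x : Fin 7 → R) : R :=
  cubicNorm a (x 0) (x 1) (x 2) + b * cubicNorm a (x 3) (x 4) (x 5) + b ^ 2 * x 6 ^ 3
    - 3 * b * x 6 * (x 0 * x 3 + a * x 1 * x 5 + a * x 2 * x 4)

section Identities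

variable {R : Type*} [CommRing R]

lemma cubicNorm_mul_eq (a x y z : R) :
    cubicNorm a x y z * (y ^ 3 + a * (-z) ^ 3)
      = (x * y - a * z ^ 2) ^ 3 + a * (y ^ 2 - x * z) ^ 3 := by
  unfold cubicNorm
  ring

lemma titsNorm_mul_eq (a b : R) (x : Fin 7 → R) :
    titsNorm a b x * (b ^ 2 * x 6 ^ 3 - cubicNorm a (x 0) (x 1) (x 2))
      = cubicNorm a (b * x 6 * x 3 - (x 0 ^ 2 - a * x 1 * x 2))
          (b * x 6 * x 4 - (a * x 2 ^ 2 - x 0 * x 1))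
          (b * x 6 * x 5 - (x 1 ^ 2 - x 0 * x 2))
        + b * cubicNorm a (b * x 6 ^ 2 - (x 0 * x 3 + a * (x 1 * x 5 + x 2 * x 4)))
          (-(x 0 * x 4 + x 1 * x 3 + a * x 2 * x 5))
          (-(x 0 * x 5 + x 2 * x 3 + x 1 * x 4)) := by
  unfold titsNorm cubicNorm
  ring

end Identities

section Values

variable {F : Type*} [Field F] {M : Type*} [AddCommGroup M] {g : Fˣ → Fˣ → M}

lemma eq_zero_of_cube_add_mul_cube {a : Fˣ} (ha : a ∉ (powMonoidHom 3 : Fˣ →* Fˣ).range)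
    {x y : F} (h : x ^ 3 + a * y ^ 3 = 0) : x = 0 ∧ y = 0 := by
  have := MemOrZero.eq_zero_of_add_mul_eq_zero le_rfl ha
    (MemOrZero.cube le_rfl x) (MemOrZero.cube le_rfl y) h
  simpa using this

lemma cubicNorm_eq_zero {a : Fˣ} (ha : a ∉ (powMonoidHom 3 : Fˣ →* Fˣ).range)
    {x y z : F} (h : cubicNorm (a : F) x y z = 0) : x = 0 ∧ y = 0 ∧ z = 0 := by
  have e := cubicNorm_mul_eq (a : F) x y z
  rw [h, zero_mul] at e
  obtain ⟨h1, h2⟩ := eq_zero_of_cube_add_mul_cube ha e.symm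
  have hyz : y ^ 3 + a * (-z) ^ 3 = 0 := by linear_combination y * h2 + z * h1
  obtain ⟨rfl, hz⟩ := eq_zero_of_cube_add_mul_cube ha hyz
  rw [neg_eq_zero] at hz
  subst hz
  exact ⟨by simpa [cubicNorm] using h, rfl, rfl⟩

lemma memOrZero_cubicNorm (hg : IsSteinberg g) (h3 : ∀ m : M, 3 • m = 0) {a : Fˣ}
    (ha : a ∉ (powMonoidHom 3 : Fˣ →* Fˣ).range) (x y z : F) :
    MemOrZero (hg.ann a) (cubicNorm (a : F) x y z) := by
  have hW : ∀ w ∈ (powMonoidHom 3 : Fˣ →* Fˣ).range, ∀ t, g w t = 0 := by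
    rintro _ ⟨w, rfl⟩ t
    exact hg.cube_left h3 w t
  have hadd (u v : F) : MemOrZero (hg.ann a) (u ^ 3 + a * v ^ 3) :=
    MemOrZero.add_mul hg h3 hW a (MemOrZero.cube le_rfl u) (MemOrZero.cube le_rfl v)
  by_cases h0 : y ^ 3 + a * (-z) ^ 3 = 0
  · obtain ⟨rfl, hz⟩ := eq_zero_of_cube_add_mul_cube ha h0
    rw [neg_eq_zero] at hz
    subst hz
    simpa [cubicNorm] using MemOrZero.cube (hg.cubes_le_ann h3 a) x
  · refine MemOrZero.of_mul_right ?_ (hadd y (-z)) h0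
    rw [cubicNorm_mul_eq]
    exact hadd _ _

variable {W : Subgroup Fˣ} {a b : Fˣ}

lemma tits_denominator_eq (c x y z : F) :
    (b : F) ^ 2 * c ^ 3 - cubicNorm (a : F) x y z
      = (cubicNorm (a : F) c 0 0 + b * cubicNorm (a : F) (-x / b) (-y / b) (-z / b)) * b ^ 2 := by
  have := b.ne_zero
  unfold cubicNorm
  field_simp
  ring

lemma eq_zero_of_tits_denominator_eq_zero (ha : a ∉ (powMonoidHom 3 : Fˣ →* Fˣ).range)
    (hW : (powMonoidHom 3 : Fˣ →* Fˣ).range ≤ W) (hb : b ∉ W)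
    (hN : ∀ x y z : F, MemOrZero W (cubicNorm (a : F) x y z)) {c x y z : F}
    (h : (b : F) ^ 2 * c ^ 3 - cubicNorm (a : F) x y z = 0) :
    c = 0 ∧ x = 0 ∧ y = 0 ∧ z = 0 := by
  rw [tits_denominator_eq, mul_eq_zero, or_iff_left (pow_ne_zero 2 b.ne_zero)] at h
  obtain ⟨h1, h2⟩ := MemOrZero.eq_zero_of_add_mul_eq_zero hW hb (hN _ _ _) (hN _ _ _) h
  have h1' := cubicNorm_eq_zero ha h1
  have h2' := cubicNorm_eq_zero ha h2
  simpa [h1'.1] using h2'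

lemma titsNorm_eq_zero (ha : a ∉ (powMonoidHom 3 : Fˣ →* Fˣ).range)
    (hW : (powMonoidHom 3 : Fˣ →* Fˣ).range ≤ W) (hb : b ∉ W)
    (hN : ∀ x y z : F, MemOrZero W (cubicNorm (a : F) x y z)) {x : Fin 7 → F}
    (h : titsNorm (a : F) b x = 0) : x = 0 := by
  have e := titsNorm_mul_eq (a : F) b x
  rw [h, zero_mul] at e
  obtain ⟨h1, h2⟩ := MemOrZero.eq_zero_of_add_mul_eq_zero hW hb (hN _ _ _) (hN _ _ _) e.symm
  obtain ⟨p0, p1, p2⟩ := cubicNorm_eq_zero ha h1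
  obtain ⟨q0, -, -⟩ := cubicNorm_eq_zero ha h2
  have hd : (b : F) ^ 2 * x 6 ^ 3 - cubicNorm (a : F) (x 0) (x 1) (x 2) = 0 := by
    unfold cubicNorm
    linear_combination b * x 6 * q0 + x 0 * p0 + a * (x 1 * p2 + x 2 * p1)
  obtain ⟨x6, x0, x1, x2⟩ := eq_zero_of_tits_denominator_eq_zero ha hW hb hN hd
  have hβ : cubicNorm (a : F) (x 3) (x 4) (x 5) = 0 := by
    have h' : (b : F) * cubicNorm (a : F) (x 3) (x 4) (x 5) = 0 := by
      rw [← h]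
      simp [titsNorm, cubicNorm, x6, x0, x1, x2]
    exact (mul_eq_zero.1 h').resolve_left b.ne_zero
  obtain ⟨x3, x4, x5⟩ := cubicNorm_eq_zero ha hβ
  funext i
  fin_cases i <;> assumption

lemma memOrZero_titsNorm (hg : IsSteinberg g) (h3 : ∀ m : M, 3 • m = 0)
    (ha : a ∉ (powMonoidHom 3 : Fˣ →* Fˣ).range)
    (hW : (powMonoidHom 3 : Fˣ →* Fˣ).range ≤ W) (hb : b ∉ W)
    (hN : ∀ x y z : F, MemOrZero W (cubicNorm (a : F) x y z))
    (hker : ∀ w ∈ W, ∀ t, g w t = 0) (x : Fin 7 → F) :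
    MemOrZero (hg.ann b) (titsNorm (a : F) b x) := by
  have hadd (u v w u' v' w' : F) : MemOrZero (hg.ann b)
      (cubicNorm (a : F) u v w + b * cubicNorm (a : F) u' v' w') :=
    MemOrZero.add_mul hg h3 hker b (hN _ _ _) (hN _ _ _)
  by_cases h0 : (b : F) ^ 2 * x 6 ^ 3 - cubicNorm (a : F) (x 0) (x 1) (x 2) = 0
  · obtain ⟨x6, x0, x1, x2⟩ := eq_zero_of_tits_denominator_eq_zero ha hW hb hN h0
    have e : titsNorm (a : F) b x
        = cubicNorm (a : F) 0 0 0 + b * cubicNorm (a : F) (x 3) (x 4) (x 5) := by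
      simp [titsNorm, x6, x0, x1, x2]
    rw [e]
    exact hadd _ _ _ _ _ _
  · refine MemOrZero.of_mul_right ?_ ?_ h0
    · rw [titsNorm_mul_eq]
      exact hadd _ _ _ _ _ _
    · rw [tits_denominator_eq]
      have hbb : b ∈ hg.ann b := hg.self h3 b
      exact (hadd _ _ _ _ _ _).mul (by simpa using MemOrZero.of_mem (pow_mem hbb 2))

end Values

/-- The form `P(x₀) + c P(x₁) + d (P(x₂) + c P(x₃))`, where `P = titsNorm a b`. -/
def quadrupleNorm {R : Type*} [CommRing R] (a b c d : R) (x : Fin 4 → Fin 7 → R) : R :=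
  (titsNorm a b (x 0) + c * titsNorm a b (x 1))
    + d * (titsNorm a b (x 2) + c * titsNorm a b (x 3))

section Homogeneity

variable {R σ : Type*} [CommRing R]

lemma isHomogeneous_mul_of_zero {n : ℕ} {p q : MvPolynomial σ R} (hp : p.IsHomogeneous 0)
    (hq : q.IsHomogeneous n) : (p * q).IsHomogeneous n := by
  simpa using hp.mul hq

lemma isHomogeneous_cubicNorm {a x y z : MvPolynomial σ R} (ha : a.IsHomogeneous 0)
    (hx : x.IsHomogeneous 1) (hy : y.IsHomogeneous 1) (hz : z.IsHomogeneous 1) :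
    (cubicNorm a x y z).IsHomogeneous 3 := by
  have h3 : (3 : MvPolynomial σ R).IsHomogeneous 0 := isHomogeneous_C σ (3 : R)
  have hxyz : (3 * a * x * y * z).IsHomogeneous 3 := by
    simpa using (((h3.mul ha).mul hx).mul hy).mul hz
  exact (((hx.pow 3).add (isHomogeneous_mul_of_zero ha (hy.pow 3))).add
    (isHomogeneous_mul_of_zero (by simpa using ha.pow 2) (hz.pow 3))).sub hxyz

lemma isHomogeneous_titsNorm {a b : MvPolynomial σ R} {x : Fin 7 → MvPolynomial σ R}
    (ha : a.IsHomogeneous 0) (hb : b.IsHomogeneous 0) (hx : ∀ i, (x i).IsHomogeneous 1) :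
    (titsNorm a b x).IsHomogeneous 3 := by
  have h3 : (3 : MvPolynomial σ R).IsHomogeneous 0 := isHomogeneous_C σ (3 : R)
  have hT : (x 0 * x 3 + a * x 1 * x 5 + a * x 2 * x 4).IsHomogeneous 2 := by
    refine (((hx 0).mul (hx 3)).add ?_).add ?_
    · simpa using (ha.mul (hx 1)).mul (hx 5)
    · simpa using (ha.mul (hx 2)).mul (hx 4)
  have hcross : (3 * b * x 6 * (x 0 * x 3 + a * x 1 * x 5 + a * x 2 * x 4)).IsHomogeneous 3 := by
    simpa using ((h3.mul hb).mul (hx 6)).mul hT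
  exact (((isHomogeneous_cubicNorm ha (hx 0) (hx 1) (hx 2)).add
    (isHomogeneous_mul_of_zero hb (isHomogeneous_cubicNorm ha (hx 3) (hx 4) (hx 5)))).add
    (isHomogeneous_mul_of_zero (by simpa using hb.pow 2) ((hx 6).pow 3))).sub hcross

lemma isHomogeneous_quadrupleNorm {a b c d : MvPolynomial σ R}
    {x : Fin 4 → Fin 7 → MvPolynomial σ R} (ha : a.IsHomogeneous 0) (hb : b.IsHomogeneous 0)
    (hc : c.IsHomogeneous 0) (hd : d.IsHomogeneous 0) (hx : ∀ i j, (x i j).IsHomogeneous 1) :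
    (quadrupleNorm a b c d x).IsHomogeneous 3 := by
  have ht (i : Fin 4) := isHomogeneous_titsNorm ha hb (hx i)
  exact ((ht 0).add (isHomogeneous_mul_of_zero hc (ht 1))).add
    (isHomogeneous_mul_of_zero hd ((ht 2).add (isHomogeneous_mul_of_zero hc (ht 3))))

lemma map_quadrupleNorm {S : Type*} [CommRing S] (f : R →+* S) (a b c d : R)
    (x : Fin 4 → Fin 7 → R) : f (quadrupleNorm a b c d x)
      = quadrupleNorm (f a) (f b) (f c) (f d) (fun i j => f (x i j)) := by
  simp [quadrupleNorm, titsNorm, cubicNorm, map_ofNat]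

end Homogeneity

/-- Over a `C_3` field, the form `quadrupleNorm` is isotropic. -/
lemma IsCField.exists_quadrupleNorm_eq_zero {F : Type*} [Field F] (hC : IsCField F 3)
    (a b c d : F) : ∃ x : Fin 4 → Fin 7 → F, x ≠ 0 ∧ quadrupleNorm a b c d x = 0 := by
  let e : Fin 4 × Fin 7 ≃ Fin 28 := finProdFinEquiv
  obtain ⟨x, hx, h⟩ := hC 3 28 (by norm_num) (by norm_num)
    (quadrupleNorm (C a) (C b) (C c) (C d) fun i j => X (e (i, j)))
    (isHomogeneous_quadrupleNorm (isHomogeneous_C _ _) (isHomogeneous_C _ _)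
      (isHomogeneous_C _ _) (isHomogeneous_C _ _) fun _ _ => isHomogeneous_X _ _)
  refine ⟨fun i j => x (e (i, j)), fun h0 => hx ?_, ?_⟩
  · funext k
    have := congrFun (congrFun h0 (e.symm k).1) (e.symm k).2
    simpa using this
  · rw [map_quadrupleNorm] at h
    simpa using h

section Symbols

variable {F : Type u} [Field F]

lemma nsmul_kMod_eq_zero {p n : ℕ} (m : kMod F p n) : p • m = 0 := by
  obtain ⟨y, rfl⟩ := QuotientAddGroup.mk_surjective m
  exact (QuotientAddGroup.eq_zero_iff (p • y)).2 (AddSubgroup.subset_closure ⟨y, rfl⟩)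

lemma symbol_eq_add (p : ℕ) {n : ℕ} (a : Fin n → Fˣ) (i : Fin n) (u v : Fˣ) (h : a i = u * v) :
    symbol F p a
      = symbol F p (Function.update a i u) + symbol F p (Function.update a i v) := by
  have h0 : (QuotientAddGroup.mk (FreeAbelianGroup.of a
      - FreeAbelianGroup.of (Function.update a i u)
      - FreeAbelianGroup.of (Function.update a i v)) : MilnorK F n) = 0 :=
    (QuotientAddGroup.eq_zero_iff _).2
      (AddSubgroup.subset_closure (Or.inl ⟨a, i, u, v, h, rfl⟩))
  have h1 : symbol F p a - symbol F p (Function.update a i u)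
      - symbol F p (Function.update a i v) = 0 :=
    congrArg (QuotientAddGroup.mk : MilnorK F n → kMod F p n) h0
  rw [sub_sub, sub_eq_zero] at h1
  exact h1

lemma symbol_eq_zero_of_add_eq_one (p : ℕ) {n : ℕ} (a : Fin n → Fˣ) (i j : Fin n)
    (hij : (i : ℕ) + 1 = j) (h : (a i : F) + a j = 1) : symbol F p a = 0 := by
  have h0 : (QuotientAddGroup.mk (FreeAbelianGroup.of a) : MilnorK F n) = 0 :=
    (QuotientAddGroup.eq_zero_iff _).2
      (AddSubgroup.subset_closure (Or.inr ⟨a, i, j, hij, h, rfl⟩))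
  exact congrArg (QuotientAddGroup.mk : MilnorK F n → kMod F p n) h0

lemma kMod_eq_zero_of_symbol_eq_zero {p n : ℕ} (h : ∀ a : Fin n → Fˣ, symbol F p a = 0)
    (α : kMod F p n) : α = 0 := by
  obtain ⟨y, rfl⟩ := QuotientAddGroup.mk_surjective α
  obtain ⟨z, rfl⟩ := QuotientAddGroup.mk_surjective y
  let f : FreeAbelianGroup (Fin n → Fˣ) →+ kMod F p n :=
    (QuotientAddGroup.mk' (pMul F p n)).comp (QuotientAddGroup.mk' (milnorRel F n))
  have hf : f = 0 := FreeAbelianGroup.lift_ext _ _ h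
  exact DFunLike.congr_fun hf z

lemma symbol_mul_zero (p : ℕ) (u v b c d : Fˣ) : symbol F p ![u * v, b, c, d]
    = symbol F p ![u, b, c, d] + symbol F p ![v, b, c, d] := by
  have e (w : Fˣ) : Function.update ![u * v, b, c, d] 0 w = ![w, b, c, d] := by
    funext i
    fin_cases i <;> rfl
  simpa only [e] using symbol_eq_add p ![u * v, b, c, d] 0 u v rfl

lemma symbol_mul_one (p : ℕ) (a u v c d : Fˣ) : symbol F p ![a, u * v, c, d]
    = symbol F p ![a, u, c, d] + symbol F p ![a, v, c, d] := by
  have e (w : Fˣ) : Function.update ![a, u * v, c, d] 1 w = ![a, w, c, d] := by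
    funext i
    fin_cases i <;> rfl
  simpa only [e] using symbol_eq_add p ![a, u * v, c, d] 1 u v rfl

lemma symbol_mul_two (p : ℕ) (a b u v d : Fˣ) : symbol F p ![a, b, u * v, d]
    = symbol F p ![a, b, u, d] + symbol F p ![a, b, v, d] := by
  have e (w : Fˣ) : Function.update ![a, b, u * v, d] 2 w = ![a, b, w, d] := by
    funext i
    fin_cases i <;> rfl
  simpa only [e] using symbol_eq_add p ![a, b, u * v, d] 2 u v rfl

lemma symbol_mul_three (p : ℕ) (a b c u v : Fˣ) : symbol F p ![a, b, c, u * v]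
    = symbol F p ![a, b, c, u] + symbol F p ![a, b, c, v] := by
  have e (w : Fˣ) : Function.update ![a, b, c, u * v] 3 w = ![a, b, c, w] := by
    funext i
    fin_cases i <;> rfl
  simpa only [e] using symbol_eq_add p ![a, b, c, u * v] 3 u v rfl

lemma isSteinberg_symbol_zero_one (p : ℕ) : IsSteinberg
    (fun (a b : Fˣ) => (fun c d => symbol F p ![a, b, c, d] : Fˣ → Fˣ → kMod F p 4)) where
  mul_left u v x := by
    funext c d
    exact symbol_mul_zero p u v x c d
  mul_right x u v := by
    funext c d
    exact symbol_mul_one p x u v c d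
  steinberg u v h := by
    funext c d
    exact symbol_eq_zero_of_add_eq_one p _ 0 1 rfl h

lemma isSteinberg_symbol_one_two (p : ℕ) (a : Fˣ) : IsSteinberg
    (fun (b c : Fˣ) => (fun d => symbol F p ![a, b, c, d] : Fˣ → kMod F p 4)) where
  mul_left u v x := by
    funext d
    exact symbol_mul_one p a u v x d
  mul_right x u v := by
    funext d
    exact symbol_mul_two p a x u v d
  steinberg u v h := by
    funext d
    exact symbol_eq_zero_of_add_eq_one p _ 1 2 rfl h

lemma isSteinberg_symbol_two_three (p : ℕ) (a b : Fˣ) : IsSteinberg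
    (fun (c d : Fˣ) => symbol F p ![a, b, c, d]) where
  mul_left u v x := symbol_mul_two p a b u v x
  mul_right x u v := symbol_mul_three p a b x u v
  steinberg _ _ h := symbol_eq_zero_of_add_eq_one p _ 2 3 rfl h

/-- A nonzero symbol in `K_4/3` makes the corresponding `quadrupleNorm` anisotropic. -/
lemma quadrupleNorm_anisotropic {a b c d : Fˣ} (h : symbol F 3 ![a, b, c, d] ≠ 0)
    {x : Fin 4 → Fin 7 → F} (hx : quadrupleNorm (a : F) b c d x = 0) : x = 0 := by
  have t3 (m : kMod F 3 4) : 3 • m = 0 := nsmul_kMod_eq_zero m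
  have t2 (m : Fˣ → kMod F 3 4) : 3 • m = 0 := funext fun _ => t3 _
  have t1 (m : Fˣ → Fˣ → kMod F 3 4) : 3 • m = 0 := funext fun _ => t2 _
  have g1 := isSteinberg_symbol_zero_one (F := F) 3
  have g2 := isSteinberg_symbol_one_two (F := F) 3 a
  have g3 := isSteinberg_symbol_two_three (F := F) 3 a b
  have hd : d ∉ g3.ann c := h
  have hc : c ∉ g2.ann b := fun hc => h (congrFun hc d)
  have hb : b ∉ g1.ann a := fun hb => h (congrFun (congrFun hb c) d)
  have ha : a ∉ (powMonoidHom 3 : Fˣ →* Fˣ).range := by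
    rintro ⟨w, rfl⟩
    exact h (congrFun (congrFun (g1.cube_left t1 w b) c) d)
  have k2 : ∀ w ∈ g1.ann a, ∀ t, (fun d => symbol F 3 ![a, w, t, d]) = 0 :=
    fun w hw t => congrFun hw t
  have k3 : ∀ w ∈ g2.ann b, ∀ t, symbol F 3 ![a, b, w, t] = 0 :=
    fun w hw t => congrFun hw t
  have c1 := g1.cubes_le_ann t1 a
  have c2 := g2.cubes_le_ann t2 b
  have hN := memOrZero_cubicNorm g1 t1 ha
  have hP := memOrZero_titsNorm g2 t2 ha c1 hb hN k2
  have hQ (u v : Fin 7 → F) := MemOrZero.add_mul g3 t3 k3 c (hP u) (hP v)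
  obtain ⟨h1, h2⟩ := MemOrZero.eq_zero_of_add_mul_eq_zero (g3.cubes_le_ann t3 c) hd
    (hQ _ _) (hQ _ _) hx
  obtain ⟨x0, x1⟩ := MemOrZero.eq_zero_of_add_mul_eq_zero c2 hc (hP _) (hP _) h1
  obtain ⟨x2, x3⟩ := MemOrZero.eq_zero_of_add_mul_eq_zero c2 hc (hP _) (hP _) h2
  funext i
  fin_cases i
  · exact titsNorm_eq_zero ha c1 hb hN x0
  · exact titsNorm_eq_zero ha c1 hb hN x1
  · exact titsNorm_eq_zero ha c1 hb hN x2
  · exact titsNorm_eq_zero ha c1 hb hN x3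

end Symbols

/-- If `F` is a field of characteristic different from `3`
with the `C_3` property, then `K_4^M(F)/3K_4^M(F) = 0`. -/
theorem kMod_four_eq_zero (F : Type u) [Field F]
    (hchar : ringChar F ≠ 3) (hC : IsCField F 3) :
    ∀ α : kMod F 3 4, α = 0 := by
  refine kMod_eq_zero_of_symbol_eq_zero fun s => ?_
  have hs : s = ![s 0, s 1, s 2, s 3] := by
    funext i
    fin_cases i <;> rfl
  rw [hs]
  by_contra h
  obtain ⟨x, hx, hx0⟩ := hC.exists_quadrupleNorm_eq_zero (s 0 : F) (s 1) (s 2) (s 3)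
  exact hx (quadrupleNorm_anisotropic h hx0)
end
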